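/- arXiv:2012.14382 — 2 statements merged into one kernel-verified Lean document; each statement's English description precedes it below -/
import Mathlib

section
/- Let H be a complex Hilbert space, let A be a bounded self-adjoint operator on H, let B be a bounded operator on H, and let g : ℝ → ℂ be measurable with ∫_ℝ |g(s)| ds < ∞ and ∫_ℝ |g(s)| |s| ds < ∞. Define f_g(A) := ∫_ℝ g(s) exp(isA) ds (Bochner integral in the bounded operators). Then [B, f_g(A)] = i ∫_ℝ g(s) ( ∫₀ˢ exp(i(s−u)A) [B,A] exp(iuA) du ) ds. -/
open scoped Complex
open MeasureTheory

lemma aux_deriv {H : Type*} [NormedAddCommGroup H] [InnerProductSpace ℂ H] [CompleteSpace H]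
    (A : H →L[ℂ] H) (u : ℝ) :
    HasDerivAt (fun u : ℝ => NormedSpace.exp ((Complex.I * u) • A))
      (NormedSpace.exp ((Complex.I * u) • A) * (Complex.I • A)) u := by
  have h := hasDerivAt_exp_smul_const (𝕂 := ℝ) (Complex.I • A) u
  have e : ∀ v : ℝ, (Complex.I * v) • A = v • (Complex.I • A) := by
    intro v
    rw [mul_comm, mul_smul, Complex.coe_smul]
  simpa only [e] using h

lemma aux_deriv' {H : Type*} [NormedAddCommGroup H] [InnerProductSpace ℂ H] [CompleteSpace H]
    (A : H →L[ℂ] H) (s u : ℝ) :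
    HasDerivAt (fun u : ℝ => NormedSpace.exp ((Complex.I * (s - u)) • A))
      (-(NormedSpace.exp ((Complex.I * (s - u)) • A) * (Complex.I • A))) u := by
  have h := (aux_deriv A (s - u)).scomp u ((hasDerivAt_id u).const_sub s)
  simpa [Function.comp_def] using h

lemma aux_comm {H : Type*} [NormedAddCommGroup H] [InnerProductSpace ℂ H] [CompleteSpace H]
    (A : H →L[ℂ] H) (c : ℂ) :
    NormedSpace.exp (c • A) * A = A * NormedSpace.exp (c • A) :=
  (((Commute.refl A).smul_left c).exp_left).eq

lemma aux_cont {H : Type*} [NormedAddCommGroup H] [InnerProductSpace ℂ H] [CompleteSpace H]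
    (A : H →L[ℂ] H) : Continuous (fun u : ℝ => NormedSpace.exp ((Complex.I * u) • A)) :=
  continuous_iff_continuousAt.2 fun u => (aux_deriv A u).continuousAt

lemma aux_cont' {H : Type*} [NormedAddCommGroup H] [InnerProductSpace ℂ H] [CompleteSpace H]
    (A : H →L[ℂ] H) (s : ℝ) :
    Continuous (fun u : ℝ => NormedSpace.exp ((Complex.I * (s - u)) • A)) :=
  continuous_iff_continuousAt.2 fun u => (aux_deriv' A s u).continuousAt

lemma aux_int {H : Type*} [NormedAddCommGroup H] [InnerProductSpace ℂ H] [CompleteSpace H]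
    (A B : H →L[ℂ] H) (s : ℝ) :
    Complex.I • ∫ u in (0:ℝ)..s,
          NormedSpace.exp ((Complex.I * (s - u)) • A) * (B * A - A * B)
            * NormedSpace.exp ((Complex.I * u) • A)
    = B * NormedSpace.exp ((Complex.I * s) • A) - NormedSpace.exp ((Complex.I * s) • A) * B := by
  rw [← intervalIntegral.integral_smul]
  rw [intervalIntegral.integral_eq_sub_of_hasDerivAt
    (f := fun u : ℝ => NormedSpace.exp ((Complex.I * (s - u)) • A) * B
      * NormedSpace.exp ((Complex.I * u) • A))]
  · simp
  · intro u _
    have h := ((aux_deriv' A s u).mul_const B).mul (aux_deriv A u)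
    refine h.congr_deriv ?_
    have e := aux_comm A (Complex.I * u)
    simp only [mul_smul_comm, smul_mul_assoc, neg_mul, mul_sub, sub_mul, smul_sub, mul_assoc, e]
    abel
  · apply Continuous.intervalIntegrable
    exact (((aux_cont' A s).mul continuous_const).mul (aux_cont A)).const_smul Complex.I

lemma aux_norm {H : Type*} [NormedAddCommGroup H] [InnerProductSpace ℂ H] [CompleteSpace H]
    (A : H →L[ℂ] H) (hA : IsSelfAdjoint A) (s : ℝ) :
    ‖NormedSpace.exp ((Complex.I * s) • A)‖ ≤ 1 := by
  let +nondep : NormedAlgebra ℚ (H →L[ℂ] H) := .restrictScalars ℚ ℂ (H →L[ℂ] H)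
  have hs : star ((Complex.I * s) • A) = -((Complex.I * s) • A) := by
    rw [star_smul, hA.star_eq, ← neg_smul]; simp
  have h : star (NormedSpace.exp ((Complex.I * s) • A)) * NormedSpace.exp ((Complex.I * s) • A)
      = 1 := by
    rw [NormedSpace.star_exp, hs,
      ← NormedSpace.exp_add_of_commute (Commute.neg_left (Commute.refl _))]
    simp
  have h2 := CStarRing.norm_star_mul_self (x := NormedSpace.exp ((Complex.I * s) • A))
  rw [h] at h2
  have h3 : ‖(1 : H →L[ℂ] H)‖ ≤ 1 := ContinuousLinearMap.norm_id_le
  nlinarith [norm_nonneg (NormedSpace.exp ((Complex.I * s) • A))]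

/-- For `A` bounded self-adjoint, `B` bounded, and `g : ℝ → ℂ` measurable with
`∫ |g| < ∞` and `∫ |g(s)||s| ds < ∞`, setting `f_g(A) = ∫ g(s) exp(isA) ds`, one has
`[B, f_g(A)] = i ∫ g(s) (∫₀ˢ exp(i(s-u)A) [B,A] exp(iuA) du) ds`. -/
theorem commutator_smoothFn_eq_integral
    {H : Type*} [NormedAddCommGroup H] [InnerProductSpace ℂ H] [CompleteSpace H]
    (A B : H →L[ℂ] H) (hA : IsSelfAdjoint A) (g : ℝ → ℂ) (hmeas : Measurable g)
    (hg0 : Integrable g) (hg1 : Integrable (fun s : ℝ => ‖g s‖ * |s|)) :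
    B * (∫ s : ℝ, g s • NormedSpace.exp ((Complex.I * s) • A))
      - (∫ s : ℝ, g s • NormedSpace.exp ((Complex.I * s) • A)) * B
    = Complex.I • ∫ s : ℝ, g s •
        ∫ u in (0:ℝ)..s,
          NormedSpace.exp ((Complex.I * (s - u)) • A) * (B * A - A * B)
            * NormedSpace.exp ((Complex.I * u) • A) := by
  have hi : Integrable (fun s : ℝ => g s • NormedSpace.exp ((Complex.I * s) • A)) := by
    refine hg0.mono (hg0.aestronglyMeasurable.smul (aux_cont A).aestronglyMeasurable) ?_
    refine Filter.Eventually.of_forall fun s => ?_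
    rw [norm_smul]
    exact mul_le_of_le_one_right (norm_nonneg _) (aux_norm A hA s)
  have h1 := ContinuousLinearMap.integral_comp_comm
    (ContinuousLinearMap.mul ℂ (H →L[ℂ] H) B) hi
  have h2 := ContinuousLinearMap.integral_comp_comm
    ((ContinuousLinearMap.mul ℂ (H →L[ℂ] H)).flip B) hi
  have i1 := ContinuousLinearMap.integrable_comp
    (ContinuousLinearMap.mul ℂ (H →L[ℂ] H) B) hi
  have i2 := ContinuousLinearMap.integrable_comp
    ((ContinuousLinearMap.mul ℂ (H →L[ℂ] H)).flip B) hi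
  simp only [ContinuousLinearMap.mul_apply', ContinuousLinearMap.flip_apply] at h1 h2 i1 i2
  rw [← h1, ← h2, ← integral_sub i1 i2, ← integral_smul]
  congr 1
  funext s
  rw [smul_comm, aux_int, smul_sub, mul_smul_comm, smul_mul_assoc]
end

section
/- Let H be a complex Hilbert space, let A be a bounded self-adjoint operator on H, let B be a bounded operator on H, let n ≥ 1, and let g : ℝ → ℂ be measurable with ∫_ℝ |g(s)| |s|^k ds < ∞ for all 0 ≤ k ≤ n. With f_g(A) := ∫_ℝ g(s) exp(isA) ds and f_g^(k)(A) := ∫_ℝ g(s) (is)^k exp(isA) ds, one has ‖ [B, f_g(A)] − Σ_{k=1}^{n−1} (1/k!) · f_g^(k)(A) · ad_A^(k)(B) ‖ ≤ (1/n!) · ‖ad_A^(n)(B)‖ · ∫_ℝ |g(s)| |s|^n ds. -/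
open scoped Complex
open MeasureTheory

/-- Iterated commutator: `ad_A^(0)(B) = B`, `ad_A^(k)(B) = [ad_A^(k-1)(B), A]`. -/
def adIter {H : Type*} [NormedAddCommGroup H] [InnerProductSpace ℂ H] [CompleteSpace H]
    (A B : H →L[ℂ] H) : ℕ → (H →L[ℂ] H)
  | 0 => B
  | k + 1 => adIter A B k * A - A * adIter A B k

section helpers
variable {H : Type*} [NormedAddCommGroup H] [InnerProductSpace ℂ H] [CompleteSpace H]

noncomputable def expI (A : H →L[ℂ] H) (s : ℝ) : H →L[ℂ] H :=
  NormedSpace.exp ((Complex.I * s) • A)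

theorem expI_hasDerivAt (A : H →L[ℂ] H) (s : ℝ) :
    HasDerivAt (expI A) (expI A s * (Complex.I • A)) s := by
  have h := hasDerivAt_exp_smul_const (𝕂 := ℝ) (Complex.I • A) s
  have e : ∀ u : ℝ, u • (Complex.I • A) = (Complex.I * u) • A := by
    intro u
    rw [mul_comm, mul_smul, Complex.coe_smul]
  simp only [e] at h
  exact h

theorem expI_hasDerivAt' (A : H →L[ℂ] H) (s : ℝ) :
    HasDerivAt (expI A) ((Complex.I • A) * expI A s) s := by
  have h := hasDerivAt_exp_smul_const' (𝕂 := ℝ) (Complex.I • A) s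
  have e : ∀ u : ℝ, u • (Complex.I • A) = (Complex.I * u) • A := by
    intro u
    rw [mul_comm, mul_smul, Complex.coe_smul]
  simp only [e] at h
  exact h

theorem expI_continuous (A : H →L[ℂ] H) : Continuous (expI A) :=
  continuous_iff_continuousAt.2 fun s => (expI_hasDerivAt A s).continuousAt

theorem expI_zero (A : H →L[ℂ] H) : expI A 0 = 1 := by
  simp [expI]

theorem expI_mul_neg (A : H →L[ℂ] H) (s : ℝ) : expI A s * expI A (-s) = 1 := by
  let +nondep : NormedAlgebra ℚ (H →L[ℂ] H) := .restrictScalars ℚ ℂ (H →L[ℂ] H)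
  unfold expI
  rw [← NormedSpace.exp_add_of_commute]
  · rw [← add_smul]; simp
  · exact ((Commute.refl A).smul_left _).smul_right _

theorem expI_unitary (A : H →L[ℂ] H) (hA : IsSelfAdjoint A) (s : ℝ) :
    expI A s ∈ unitary (H →L[ℂ] H) := by
  let +nondep : NormedAlgebra ℚ (H →L[ℂ] H) := .restrictScalars ℚ ℂ (H →L[ℂ] H)
  unfold expI
  apply NormedSpace.exp_mem_unitary_of_mem_skewAdjoint
  rw [skewAdjoint.mem_iff, star_smul, hA.star_eq]
  simp

theorem expI_norm_mul (A : H →L[ℂ] H) (hA : IsSelfAdjoint A) (s : ℝ) (X : H →L[ℂ] H) :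
    ‖expI A s * X‖ = ‖X‖ :=
  CStarRing.norm_coe_unitary_mul ⟨_, expI_unitary A hA s⟩ X

theorem expI_norm_mul' (A : H →L[ℂ] H) (hA : IsSelfAdjoint A) (s : ℝ) (X : H →L[ℂ] H) :
    ‖X * expI A s‖ = ‖X‖ :=
  CStarRing.norm_mul_coe_unitary X ⟨_, expI_unitary A hA s⟩

theorem expI_norm_le (A : H →L[ℂ] H) (hA : IsSelfAdjoint A) (s : ℝ) : ‖expI A s‖ ≤ 1 := by
  have := expI_norm_mul A hA s 1
  rw [mul_one] at this
  rw [this]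
  exact ContinuousLinearMap.norm_id_le

theorem adIter_shift (A B : H →L[ℂ] H) (k : ℕ) :
    adIter A B (k + 1) = adIter A (B * A - A * B) k := by
  induction k with
  | zero => rfl
  | succ k ih => rw [adIter, ih]; rfl

noncomputable def remI (A B : H →L[ℂ] H) (n : ℕ) (s : ℝ) : H →L[ℂ] H :=
  expI A (-s) * B * expI A s
    - ∑ k ∈ Finset.range n, (((k.factorial : ℂ))⁻¹ * (Complex.I * s) ^ k) • adIter A B k

theorem remI_hasDerivAt (A B : H →L[ℂ] H) (n : ℕ) (s : ℝ) :
    HasDerivAt (remI A B (n + 1)) (Complex.I • remI A (B * A - A * B) n s) s := by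
  have h1 : HasDerivAt (fun s : ℝ => expI A (-s)) (-(expI A (-s) * (Complex.I • A))) s := by
    have := (expI_hasDerivAt A (-s)).scomp s (hasDerivAt_neg s)
    simpa using! this
  have h2 := (h1.mul_const B).mul (expI_hasDerivAt' A s)
  have h3 : ∀ k : ℕ, HasDerivAt
      (fun s : ℝ => ((((k+1).factorial : ℂ))⁻¹ * (Complex.I * s) ^ (k+1)) • adIter A B (k+1))
      (Complex.I • ((((k.factorial : ℂ))⁻¹ * (Complex.I * s) ^ k) •
        adIter A (B * A - A * B) k)) s := by
    intro k
    have a : HasDerivAt (fun s : ℝ => Complex.I * (s : ℂ)) Complex.I s := by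
      simpa using (Complex.ofRealCLM.hasDerivAt (x := s)).const_mul Complex.I
    have b := ((a.pow (k+1)).const_mul (((k+1).factorial : ℂ))⁻¹).smul_const (adIter A B (k+1))
    refine HasDerivAt.congr_deriv b ?_
    symm
    rw [adIter_shift, smul_smul]
    congr 1
    have : (k.factorial : ℂ) ≠ 0 := by exact_mod_cast k.factorial_ne_zero
    have : ((k:ℂ)+1) ≠ 0 := by exact_mod_cast k.succ_ne_zero
    rw [Nat.factorial_succ]
    push_cast
    field_simp
  have h4 := h2.sub (((HasDerivAt.fun_sum (u := Finset.range n) fun k _ => h3 k)).add_const B)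
  have e : remI A B (n+1) = fun s : ℝ => expI A (-s) * B * expI A s -
      ((∑ k ∈ Finset.range n,
        ((((k+1).factorial : ℂ))⁻¹ * (Complex.I * s) ^ (k+1)) • adIter A B (k+1)) + B) := by
    funext s
    rw [remI, Finset.sum_range_succ']
    simp [adIter]
  rw [e]
  refine h4.congr_deriv ?_
  rw [remI, smul_sub, Finset.smul_sum]
  congr 1
  simp only [mul_sub, sub_mul, smul_sub, mul_assoc, neg_mul, mul_smul_comm, smul_mul_assoc]
  abel

theorem remI_norm_le (A : H →L[ℂ] H) (hA : IsSelfAdjoint A) (n : ℕ) :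
    ∀ (B : H →L[ℂ] H) (s : ℝ),
      ‖remI A B n s‖ ≤ ((n.factorial : ℝ))⁻¹ * ‖adIter A B n‖ * |s| ^ n := by
  induction n with
  | zero =>
    intro B s
    simp [remI, expI_norm_mul' A hA, expI_norm_mul A hA, adIter]
  | succ n ih =>
    intro B s
    have hd : ∀ t : ℝ, HasDerivAt (fun t : ℝ => remI A B (n+1) (t * s))
        (s • (Complex.I • remI A (B * A - A * B) n (t * s))) t := fun t =>
      HasDerivAt.scomp (g₁ := remI A B (n+1)) t (remI_hasDerivAt A B n (t * s))
        (hasDerivAt_mul_const s)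
    have hB : ∀ t : ℝ, HasDerivAt
        (fun t : ℝ => (((n+1).factorial : ℝ))⁻¹ * ‖adIter A B (n+1)‖ * |s| ^ (n+1) * t ^ (n+1))
        (((n.factorial : ℝ))⁻¹ * ‖adIter A B (n+1)‖ * |s| ^ (n+1) * t ^ n) t := by
      intro t
      have := (hasDerivAt_pow (n+1) t).const_mul
        ((((n+1).factorial : ℝ))⁻¹ * ‖adIter A B (n+1)‖ * |s| ^ (n+1))
      refine this.congr_deriv ?_
      have : (n.factorial : ℝ) ≠ 0 := by exact_mod_cast n.factorial_ne_zero
      have : ((n:ℝ)+1) ≠ 0 := by exact_mod_cast n.succ_ne_zero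
      rw [Nat.factorial_succ]
      push_cast
      field_simp
    have key := image_norm_le_of_norm_deriv_right_le_deriv_boundary (a := 0) (b := 1)
      (fun t _ => (hd t).continuousAt.continuousWithinAt)
      (fun t _ => (hd t).hasDerivWithinAt) (B := _) (B' := _) ?_ hB ?_
      (Set.right_mem_Icc.2 zero_le_one)
    · simpa using key
    · have : remI A B (n+1) 0 = 0 := by
        rw [remI, Finset.sum_range_succ']
        simp [expI_zero, adIter]
      simp [this]
    · intro t ht
      rw [norm_smul, norm_smul, Complex.norm_I, one_mul, Real.norm_eq_abs]
      calc _ ≤ |s| * _ := mul_le_mul_of_nonneg_left (ih _ _) (abs_nonneg s)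
        _ = _ := by
          rw [adIter_shift, abs_mul, abs_of_nonneg ht.1]; ring

theorem commutator_expI (A B : H →L[ℂ] H) (n : ℕ) (hn : 1 ≤ n) (s : ℝ) :
    B * expI A s - expI A s * B - ∑ k ∈ Finset.Icc 1 (n - 1),
      (((k.factorial : ℂ))⁻¹ * (Complex.I * s) ^ k) • (expI A s * adIter A B k)
      = expI A s * remI A B n s := by
  obtain ⟨m, rfl⟩ : ∃ m, n = m + 1 := ⟨n - 1, by omega⟩
  have e : Finset.Icc 1 (m + 1 - 1) = Finset.Ico 1 (m + 1) := by
    ext x; simp only [Finset.mem_Icc, Finset.mem_Ico]; omega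
  rw [e, remI, mul_sub, Finset.range_eq_Ico, Finset.sum_eq_sum_Ico_succ_bot (Nat.succ_pos m),
    mul_add, ← mul_assoc, ← mul_assoc, expI_mul_neg, Finset.mul_sum]
  simp only [mul_smul_comm]
  simp [adIter, sub_sub]

theorem integrable_gI (A : H →L[ℂ] H) (hA : IsSelfAdjoint A) (k : ℕ)
    (g : ℝ → ℂ) (hmeas : Measurable g)
    (hg : Integrable (fun s : ℝ => ‖g s‖ * |s| ^ k)) :
    Integrable (fun s : ℝ => (g s * (Complex.I * s) ^ k) • expI A s) := by
  refine hg.mono' ?_ ?_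
  · have h1 : AEStronglyMeasurable (fun s : ℝ => g s * (Complex.I * s) ^ k) volume :=
      (by fun_prop : Measurable fun s : ℝ => g s * (Complex.I * s) ^ k).aestronglyMeasurable
    exact h1.smul (expI_continuous A).aestronglyMeasurable
  · refine Filter.Eventually.of_forall fun s => ?_
    rw [norm_smul]
    refine (mul_le_of_le_one_right (norm_nonneg _) (expI_norm_le A hA s)).trans ?_
    simp

end helpers

/-- With `f_g(A) = ∫ g(s) exp(isA) ds` and
`f_g^(k)(A) = ∫ g(s) (is)^k exp(isA) ds`, for `A` bounded self-adjoint, `B` bounded, `n ≥ 1`,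
and `g` measurable with `∫ |g(s)||s|^k ds < ∞` for all `0 ≤ k ≤ n`:
`‖[B, f_g(A)] - Σ_{k=1}^{n-1} (1/k!) f_g^(k)(A) ad_A^(k)(B)‖ ≤ (1/n!) ‖ad_A^(n)(B)‖ ∫ |g(s)||s|^n ds`. -/
theorem commutator_smoothFn_expansion_bound
    {H : Type*} [NormedAddCommGroup H] [InnerProductSpace ℂ H] [CompleteSpace H]
    (A B : H →L[ℂ] H) (hA : IsSelfAdjoint A) (n : ℕ) (hn : 1 ≤ n)
    (g : ℝ → ℂ) (hmeas : Measurable g)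
    (hg : ∀ k : ℕ, k ≤ n → Integrable (fun s : ℝ => ‖g s‖ * |s| ^ k)) :
    ‖(B * (∫ s : ℝ, g s • NormedSpace.exp ((Complex.I * s) • A))
        - (∫ s : ℝ, g s • NormedSpace.exp ((Complex.I * s) • A)) * B)
      - ∑ k ∈ Finset.Icc 1 (n - 1), ((k.factorial : ℂ))⁻¹ •
          ((∫ s : ℝ, (g s * (Complex.I * s) ^ k) • NormedSpace.exp ((Complex.I * s) • A))
            * adIter A B k)‖
      ≤ ((n.factorial : ℝ))⁻¹ * ‖adIter A B n‖ * ∫ s : ℝ, ‖g s‖ * |s| ^ n := by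
  change ‖(B * (∫ s : ℝ, g s • expI A s) - (∫ s : ℝ, g s • expI A s) * B)
      - ∑ k ∈ Finset.Icc 1 (n - 1), ((k.factorial : ℂ))⁻¹ •
          ((∫ s : ℝ, (g s * (Complex.I * s) ^ k) • expI A s) * adIter A B k)‖ ≤ _
  have hi : ∀ k ≤ n, Integrable (fun s : ℝ => (g s * (Complex.I * s) ^ k) • expI A s) :=
    fun k hk => integrable_gI A hA k g hmeas (hg k hk)
  have h0 : Integrable (fun s : ℝ => g s • expI A s) := by simpa using hi 0 (Nat.zero_le _)
  have hk : ∀ k ∈ Finset.Icc 1 (n - 1), Integrable (fun s : ℝ => ((k.factorial : ℂ))⁻¹ •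
      (((g s * (Complex.I * s) ^ k) • expI A s) * adIter A B k)) := by
    intro k hk
    have h1 := (hi k (by have := Finset.mem_Icc.1 hk; omega)).mul_const (adIter A B k)
    exact h1.smul ((k.factorial : ℂ))⁻¹
  have hs : ∑ k ∈ Finset.Icc 1 (n - 1), ((k.factorial : ℂ))⁻¹ •
        ((∫ s : ℝ, (g s * (Complex.I * s) ^ k) • expI A s) * adIter A B k)
      = ∫ s : ℝ, ∑ k ∈ Finset.Icc 1 (n - 1), ((k.factorial : ℂ))⁻¹ •
        (((g s * (Complex.I * s) ^ k) • expI A s) * adIter A B k) := by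
    rw [integral_finsetSum _ hk]
    refine Finset.sum_congr rfl fun k hk' => ?_
    rw [integral_smul, integral_mul_const_of_integrable
      (hi k (by have := Finset.mem_Icc.1 hk'; omega))]
  have hd : Integrable (fun s : ℝ => B * g s • expI A s - g s • expI A s * B) :=
    (h0.const_mul B).sub (h0.mul_const B)
  rw [hs, ← integral_const_mul_of_integrable h0, ← integral_mul_const_of_integrable h0,
    ← integral_sub (h0.const_mul B) (h0.mul_const B),
    ← integral_sub hd (integrable_finsetSum _ hk),
    ← integral_const_mul]
  refine norm_integral_le_of_norm_le ((hg n le_rfl).const_mul _) ?_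
  refine Filter.Eventually.of_forall fun s => ?_
  have e : B * g s • expI A s - g s • expI A s * B - ∑ k ∈ Finset.Icc 1 (n - 1),
      ((k.factorial : ℂ))⁻¹ • (((g s * (Complex.I * s) ^ k) • expI A s) * adIter A B k)
      = g s • (expI A s * remI A B n s) := by
    rw [← commutator_expI A B n hn s, smul_sub, smul_sub, Finset.smul_sum]
    simp only [mul_smul_comm, smul_mul_assoc, smul_smul]
    congr 1
    refine Finset.sum_congr rfl fun k _ => ?_
    congr 1
    ring
  simp only [e]
  rw [norm_smul, expI_norm_mul A hA]
  calc _ ≤ ‖g s‖ * _ := mul_le_mul_of_nonneg_left (remI_norm_le A hA n B s) (norm_nonneg _)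
    _ = _ := by ring
end
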